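/- arXiv:1504.02513 — 2 statements merged into one kernel-verified Lean document; each statement's English description precedes it below -/
import Mathlib

section
/- For every d ≥ 2, the number of permutations of {1,...,d+3} containing an increasing subsequence of length d equals (1/6)d^6 + d^5 + (5/3)d^4 + (2/3)d^3 + (19/6)d^2 + (31/3)d + 11, i.e. 6·B_d(d+3) = d^6 + 6d^5 + 10d^4 + 4d^3 + 19d^2 + 62d + 66. -/
/-- `σ` has an increasing subsequence of length `k`. -/
def ContainsInc (n k : ℕ) (σ : Equiv.Perm (Fin n)) : Prop :=
  ∃ s : Fin k → Fin n, StrictMono s ∧ StrictMono (fun i => σ (s i))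

/-- `B d n`: number of permutations of length `n` containing an increasing
subsequence of length `d`. -/
noncomputable def B (d n : ℕ) : ℕ := Nat.card {σ : Equiv.Perm (Fin n) // ContainsInc n d σ}

/-- `G d n`: number of permutations of length `n` avoiding an increasing
subsequence of length `d`. -/
noncomputable def G (d n : ℕ) : ℕ := Nat.card {σ : Equiv.Perm (Fin n) // ¬ ContainsInc n d σ}


/-! Reversed lattice words (head = last letter) and Schensted insertion via growth diagrams. -/

def ins : List ℕ → ℕ → List ℕ × ℕ
  | [], _ => ([0], 0)
  | s :: w, v =>
    if w.length < v then (0 :: s :: w, 0)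
    else if s = (ins w v).2 then (((ins w v).2 + 1) :: (ins w v).1, (ins w v).2 + 1)
    else (s :: (ins w v).1, (ins w v).2)

def del : List ℕ → ℕ → List ℕ × ℕ
  | [], _ => ([], 0)
  | s :: w, 0 => if s = 0 then (w, w.length) else (s :: (del w 0).1, (del w 0).2)
  | s :: w, r + 1 =>
    if s = r + 1 then (r :: (del w r).1, (del w r).2)
    else (s :: (del w (r + 1)).1, (del w (r + 1)).2)

def Latt : List ℕ → Prop
  | [] => True
  | s :: w => Latt w ∧ (s = 0 ∨ w.count s < w.count (s - 1))

lemma Latt.anti {w : List ℕ} (h : Latt w) (r : ℕ) : w.count (r + 1) ≤ w.count r := by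
  induction w with
  | nil => simp
  | cons s w ih =>
    obtain ⟨h1, h2⟩ := h
    have := ih h1
    simp only [List.count_cons, beq_iff_eq]
    rcases h2 with rfl | h2
    · simp; omega
    · by_cases hs : s = r + 1
      · subst hs; simp at h2 ⊢; omega
      · simp [hs]; omega

lemma ins_len (w : List ℕ) (v : ℕ) : (ins w v).1.length = w.length + 1 := by
  induction w with
  | nil => simp [ins]
  | cons s w ih => simp only [ins]; split_ifs <;> simp [ih]

lemma ins_count (w : List ℕ) (v x : ℕ) :
    (ins w v).1.count x = w.count x + if x = (ins w v).2 then 1 else 0 := by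
  induction w with
  | nil => by_cases h : x = 0 <;> simp [ins, List.count_cons, h, eq_comm (a := 0) (b := x)]
  | cons s w ih =>
    simp only [ins]; split_ifs <;> simp only [List.count_cons, beq_iff_eq, ih] at * <;>
      split_ifs <;> omega

lemma ins_latt {w : List ℕ} (hw : Latt w) (v : ℕ) : Latt (ins w v).1 := by
  induction w with
  | nil => simp [ins, Latt]
  | cons s w ih =>
    obtain ⟨h1, h2⟩ := hw
    have ih := ih h1
    simp only [ins]
    split_ifs with ha hb
    · exact ⟨⟨h1, h2⟩, Or.inl rfl⟩
    · refine ⟨ih, Or.inr ?_⟩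
      simp only [ins_count]
      have := h1.anti (ins w v).2
      simp; omega
    · refine ⟨ih, ?_⟩
      rcases h2 with rfl | h2
      · left; rfl
      · right
        simp only [ins_count]
        split_ifs <;> omega

lemma del_ins (w : List ℕ) (v : ℕ) (hv : v ≤ w.length) :
    del (ins w v).1 (ins w v).2 = (w, v) := by
  induction w with
  | nil => simp at hv; simp [ins, del, hv]
  | cons s w ih =>
    simp only [ins]
    split_ifs with ha hb
    · simp at hv; simp [del]; omega
    · have := ih (by omega)
      simp [del, this, hb]
    · have := ih (by omega)
      cases h : (ins w v).2 with
      | zero => rw [h] at this hb; simp [del, this, hb]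
      | succ r => rw [h] at this hb; simp [del, this, hb]

lemma del_spec {w : List ℕ} (hw : Latt w) (r : ℕ) (hr : w.count (r + 1) < w.count r) :
    Latt (del w r).1 ∧ (del w r).2 ≤ (del w r).1.length ∧ (del w r).1.length + 1 = w.length ∧
      (∀ x, (del w r).1.count x + (if x = r then 1 else 0) = w.count x) ∧
      ins (del w r).1 (del w r).2 = (w, r) := by
  induction w generalizing r with
  | nil => simp at hr
  | cons s w ih =>
    obtain ⟨h1, h2⟩ := hw
    cases r with
    | zero =>
      simp only [del]
      split_ifs with hs
      · subst hs
        refine ⟨h1, le_rfl, rfl, fun x => by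
          simp only [List.count_cons, beq_iff_eq]; split_ifs <;> omega, ?_⟩
        cases w with
        | nil => simp [ins]
        | cons t w => simp [ins]
      · have hr' : w.count (0 + 1) < w.count 0 := by
          simp only [List.count_cons, beq_iff_eq] at hr; split_ifs at hr <;> omega
        obtain ⟨i1, i2, i3, i4, i5⟩ := ih h1 0 hr'
        refine ⟨⟨i1, ?_⟩, by simp; omega, by simp [i3], ?_, ?_⟩
        · right
          have a := i4 s
          have b := i4 (s - 1)
          by_cases hs1 : s = 1
          · subst hs1; simp [List.count_cons] at a b h2 hr hr' ⊢; omega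
          · have : s - 1 ≠ 0 := by omega
            simp [this, hs] at a b h2; omega
        · intro x; have := i4 x; simp only [List.count_cons, beq_iff_eq]; omega
        · simp only [ins, i5]; simp [hs]; omega
    | succ r =>
      simp only [del]
      split_ifs with hs
      · subst hs
        have hr' : w.count (r + 1) < w.count r := by simpa using h2
        obtain ⟨i1, i2, i3, i4, i5⟩ := ih h1 r hr'
        refine ⟨⟨i1, ?_⟩, by simp; omega, by simp [i3], ?_, ?_⟩
        · by_cases h0 : r = 0
          · left; exact h0
          · right
            have a := i4 r
            have b := i4 (r - 1)
            have c := h1.anti (r - 1)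
            have e : r - 1 + 1 = r := by omega
            have : r - 1 ≠ r := by omega
            rw [e] at c
            simp [this] at a b; omega
        · intro x; have := i4 x; simp only [List.count_cons, beq_iff_eq]
          split_ifs at * <;> omega
        · simp only [ins, i5]; simp; omega
      · have hr' : w.count (r + 1 + 1) < w.count (r + 1) := by
          simp only [List.count_cons, beq_iff_eq] at hr; split_ifs at hr <;> omega
        obtain ⟨i1, i2, i3, i4, i5⟩ := ih h1 (r + 1) hr'
        refine ⟨⟨i1, ?_⟩, by simp; omega, by simp [i3], ?_, ?_⟩
        · rcases h2 with h2 | h2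
          · exact Or.inl h2
          right
          have a := i4 s
          have b := i4 (s - 1)
          by_cases hs1 : s = r + 1 + 1
          · subst hs1
            simp only [List.count_cons_self, Nat.add_sub_cancel, List.count_cons, beq_iff_eq] at a b h2 hr hr' ⊢
            simp at a b h2 hr
            omega
          · have : s - 1 ≠ r + 1 := by omega
            simp [this, hs] at a b h2; omega
        · intro x; have := i4 x; simp only [List.count_cons, beq_iff_eq]; omega
        · simp only [ins, i5]; simp [hs]; omega

/-- number of zeros among the first `c` letters -/
def LL : List ℕ → ℕ → ℕ
  | [], _ => 0
  | s :: w, c => if w.length < c then (s :: w).count 0 else LL w c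

lemma LL_full (w : List ℕ) (c : ℕ) (h : w.length ≤ c) : LL w c = w.count 0 := by
  cases w with
  | nil => simp [LL]
  | cons s w => simp at h; simp only [LL]; rw [if_pos (by omega)]

lemma LL_le (w : List ℕ) (c : ℕ) : LL w c ≤ w.count 0 := by
  induction w with
  | nil => simp [LL]
  | cons s w ih =>
    simp only [LL]; split_ifs
    · rfl
    · rw [List.count_cons]; omega

lemma ins_zero_iff (w : List ℕ) (v : ℕ) (hv : v ≤ w.length) :
    (ins w v).2 = 0 ↔ w.count 0 = LL w v := by
  induction w with
  | nil => simp [ins, LL]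
  | cons s w ih =>
    simp only [ins, LL]
    split_ifs with ha hb
    · simp
    · have := ih (by omega)
      have := LL_le w v
      by_cases h0 : s = 0 <;> simp [h0, List.count_cons] <;> omega
    · have := ih (by omega)
      have := LL_le w v
      by_cases h0 : s = 0 <;> simp [h0, List.count_cons] <;> omega

lemma ins_count_zero (w : List ℕ) (v : ℕ) (hv : v ≤ w.length) :
    (ins w v).1.count 0 = max (w.count 0) (LL w v + 1) := by
  rw [ins_count]
  have := ins_zero_iff w v hv
  have := LL_le w v
  split_ifs <;> omega

lemma LL_ins_low (w : List ℕ) (v c : ℕ) (hv : v ≤ w.length) (hc : c ≤ v) :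
    LL (ins w v).1 c = LL w c := by
  induction w with
  | nil => simp at hv; subst hv; simp at hc; subst hc; simp [ins, LL]
  | cons s w ih =>
    simp only [List.length_cons] at hv
    simp only [ins]
    split_ifs with ha hb
    · conv_lhs => rw [LL]
      rw [if_neg (by simp; omega)]
    all_goals
      have := ih (by omega)
      simp only [LL, ins_len]
      rw [if_neg (by omega), if_neg (by omega), this]

lemma LL_ins_high (w : List ℕ) (v c : ℕ) (hc : c ≤ w.length) (hv : v ≤ c) :
    LL (ins w v).1 (c + 1) = max (LL w c) (LL w v + 1) := by
  by_cases hcw : c = w.length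
  · subst hcw
    rw [LL_full _ _ (by rw [ins_len]), ins_count_zero _ _ hv, LL_full w _ le_rfl]
  induction w with
  | nil => simp at hc hcw; omega
  | cons s w ih =>
    simp only [List.length_cons] at hc hcw
    have key : LL (ins (s :: w) v).1 (c + 1) = LL (ins w v).1 (c + 1) := by
      simp only [ins]
      split_ifs with ha hb
      · omega
      all_goals
        simp only [LL, ins_len]
        rw [if_neg (by omega)]
    rw [key]
    have e1 : LL (s :: w) c = LL w c := by rw [LL, if_neg (by omega)]
    have e2 : LL (s :: w) v = LL w v := by rw [LL, if_neg (by omega)]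
    rw [e1, e2]
    by_cases h : c = w.length
    · subst h
      rw [LL_full _ _ (by rw [ins_len]), ins_count_zero _ _ hv, LL_full w _ le_rfl]
    · exact ih (by omega) h

/-! Permutations -/

def extP {n : ℕ} (τ : Equiv.Perm (Fin n)) (v : Fin (n + 1)) : Fin (n + 1) → Fin (n + 1) :=
  Fin.lastCases v (fun i => v.succAbove (τ i))

@[simp] lemma extP_last {n : ℕ} (τ : Equiv.Perm (Fin n)) (v : Fin (n + 1)) :
    extP τ v (Fin.last n) = v := by simp [extP]

@[simp] lemma extP_cast {n : ℕ} (τ : Equiv.Perm (Fin n)) (v : Fin (n + 1)) (i : Fin n) :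
    extP τ v i.castSucc = v.succAbove (τ i) := by simp [extP]

lemma extP_inj {n : ℕ} (τ : Equiv.Perm (Fin n)) (v : Fin (n + 1)) :
    Function.Injective (extP τ v) := by
  intro a b
  refine Fin.lastCases ?_ (fun i => ?_) a <;> refine Fin.lastCases ?_ (fun j => ?_) b
  · simp
  · intro h; simp at h
  · intro h; simp at h
  · intro h; simpa using h

noncomputable def extE {n : ℕ} (p : Equiv.Perm (Fin n) × Fin (n + 1)) :
    Equiv.Perm (Fin (n + 1)) :=
  Equiv.ofBijective (extP p.1 p.2) (Finite.injective_iff_bijective.mp (extP_inj p.1 p.2))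

lemma extE_bij (n : ℕ) : Function.Bijective (extE (n := n)) := by
  rw [Fintype.bijective_iff_injective_and_card]
  refine ⟨?_, ?_⟩
  · rintro ⟨τ, v⟩ ⟨τ', v'⟩ h
    have h' : ∀ i, extP τ v i = extP τ' v' i := fun i => DFunLike.congr_fun h i
    have hv := h' (Fin.last n)
    simp at hv
    subst hv
    have : τ = τ' := by
      ext i
      have := h' i.castSucc
      simp at this
      rw [this]
    rw [this]
  · simp [Fintype.card_perm, Nat.factorial_succ, mul_comm]

noncomputable def extEquiv (n : ℕ) :
    Equiv.Perm (Fin n) × Fin (n + 1) ≃ Equiv.Perm (Fin (n + 1)) :=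
  Equiv.ofBijective extE (extE_bij n)

def Inc {n : ℕ} (f : Fin n → Fin n) (k c : ℕ) : Prop :=
  ∃ s : Fin k → Fin n, StrictMono s ∧ StrictMono (fun i => f (s i)) ∧ ∀ i, (f (s i)).val < c

lemma succAbove_lt_low {n : ℕ} (v : Fin (n + 1)) (x : Fin n) (c : ℕ) (hc : c ≤ v.val) :
    (v.succAbove x).val < c ↔ x.val < c := by
  simp only [Fin.succAbove, Fin.lt_def, Fin.val_castSucc]
  split_ifs <;> simp <;> omega

lemma succAbove_lt_high {n : ℕ} (v : Fin (n + 1)) (x : Fin n) (c : ℕ) (hc : v.val ≤ c) :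
    (v.succAbove x).val < c + 1 ↔ x.val < c := by
  simp only [Fin.succAbove, Fin.lt_def, Fin.val_castSucc]
  split_ifs <;> simp <;> omega

lemma inc_of_sub {n : ℕ} (τ : Equiv.Perm (Fin n)) (v : Fin (n + 1)) (k c c' : ℕ)
    (hcc : ∀ x : Fin n, (v.succAbove x).val < c' ↔ x.val < c) (h : Inc τ k c) :
    Inc (extP τ v) k c' := by
  obtain ⟨s, h1, h2, h3⟩ := h
  refine ⟨fun i => (s i).castSucc, fun i j hij => ?_, fun i j hij => ?_, fun i => ?_⟩
  · simpa using h1 hij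
  · simpa using h2 hij
  · simpa [hcc] using h3 i

lemma sub_of_inc {n : ℕ} (τ : Equiv.Perm (Fin n)) (v : Fin (n + 1)) (k c c' : ℕ)
    (hcc : ∀ x : Fin n, (v.succAbove x).val < c' ↔ x.val < c)
    (s : Fin k → Fin (n + 1)) (h1 : StrictMono s) (h2 : StrictMono (fun i => extP τ v (s i)))
    (h3 : ∀ i, (extP τ v (s i)).val < c') (h4 : ∀ i, s i ≠ Fin.last n) :
    Inc τ k c := by
  have : ∀ i, ∃ j : Fin n, j.castSucc = s i := fun i => Fin.exists_castSucc_eq.mpr (h4 i)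
  choose t ht using this
  refine ⟨t, fun i j hij => ?_, fun i j hij => ?_, fun i => ?_⟩
  · have := h1 hij
    rw [← ht, ← ht] at this
    simpa using this
  · have := h2 hij
    simp only [← ht] at this
    simpa using this
  · have := h3 i
    simp only [← ht] at this
    simpa [hcc] using this

lemma inc_low {n : ℕ} (τ : Equiv.Perm (Fin n)) (v : Fin (n + 1)) (k c : ℕ) (hc : c ≤ v.val) :
    Inc (extP τ v) k c ↔ Inc τ k c := by
  constructor
  · rintro ⟨s, h1, h2, h3⟩
    refine sub_of_inc τ v k c c (fun x => succAbove_lt_low v x c hc) s h1 h2 h3 ?_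
    intro i hi
    have := h3 i
    rw [hi] at this
    simp at this
    omega
  · exact inc_of_sub τ v k c c (fun x => succAbove_lt_low v x c hc)

lemma inc_high {n : ℕ} (τ : Equiv.Perm (Fin n)) (v : Fin (n + 1)) (k c : ℕ) (hc : v.val ≤ c) :
    Inc (extP τ v) k (c + 1) ↔ Inc τ k c ∨ ∃ k', k = k' + 1 ∧ Inc τ k' v.val := by
  constructor
  · rintro ⟨s, h1, h2, h3⟩
    by_cases h4 : ∀ i, s i ≠ Fin.last n
    · left
      exact sub_of_inc τ v k c _ (fun x => succAbove_lt_high v x c hc) s h1 h2 h3 h4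
    · right
      push Not at h4
      obtain ⟨i, hi⟩ := h4
      cases k with
      | zero => exact i.elim0
      | succ k =>
        refine ⟨k, rfl, ?_⟩
        have hil : i = Fin.last k := by
          by_contra hne
          have := h1 (lt_of_le_of_ne (Fin.le_last i) hne)
          rw [hi] at this
          exact absurd (Fin.le_last (s (Fin.last k))) (not_le.mpr this)
        subst hil
        refine sub_of_inc τ v k v.val v.val (fun x => succAbove_lt_low v x _ le_rfl)
          (fun j => s j.castSucc) (fun a b hab => h1 (by simpa using hab))
          (fun a b hab => h2 (by simpa using hab)) ?_ ?_
        · intro j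
          have := h2 (Fin.castSucc_lt_last j)
          simp only [hi, extP_last] at this
          exact this
        · intro j hj
          have := h1 (Fin.castSucc_lt_last j)
          rw [hi, hj] at this
          exact lt_irrefl _ this
  · rintro (h | ⟨k', rfl, h⟩)
    · exact inc_of_sub τ v k c _ (fun x => succAbove_lt_high v x c hc) h
    · obtain ⟨s, h1, h2, h3⟩ :=
        inc_of_sub τ v k' v.val v.val (fun x => succAbove_lt_low v x _ le_rfl) h
      have hne : ∀ i, s i < Fin.last n := by
        intro i
        refine lt_of_le_of_ne (Fin.le_last _) fun hi => ?_
        have := h3 i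
        rw [hi] at this
        simp at this
      refine ⟨Fin.snoc (α := fun _ => Fin (n + 1)) s (Fin.last n), ?_, ?_, ?_⟩
      · intro a b
        refine Fin.lastCases ?_ (fun i => ?_) a <;> refine Fin.lastCases ?_ (fun j => ?_) b
        · intro h; exact absurd h (lt_irrefl _)
        · intro h; exact absurd h (not_lt.mpr (Fin.le_last _))
        · intro _; simpa using hne i
        · intro h; simpa using h1 (by simpa using h)
      · intro a b
        refine Fin.lastCases ?_ (fun i => ?_) a <;> refine Fin.lastCases ?_ (fun j => ?_) b
        · intro h; exact absurd h (lt_irrefl _)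
        · intro h; exact absurd h (not_lt.mpr (Fin.le_last _))
        · intro _; simpa using h3 i
        · intro h; simpa using h2 (by simpa using h)
      · intro a
        refine Fin.lastCases ?_ (fun i => ?_) a
        · simp; omega
        · have := h3 i; simp; omega

noncomputable def st : (n : ℕ) → Equiv.Perm (Fin n) → List ℕ
  | 0, _ => []
  | n + 1, σ => (ins (st n ((extEquiv n).symm σ).1) ((extEquiv n).symm σ).2.val).1

lemma st_ext (n : ℕ) (p : Equiv.Perm (Fin n) × Fin (n + 1)) :
    st (n + 1) (extEquiv n p) = (ins (st n p.1) p.2.val).1 := by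
  simp [st]

lemma st_len (n : ℕ) (σ : Equiv.Perm (Fin n)) : (st n σ).length = n := by
  induction n with
  | zero => simp [st]
  | succ n ih => simp [st, ins_len, ih]

lemma st_latt (n : ℕ) (σ : Equiv.Perm (Fin n)) : Latt (st n σ) := by
  induction n with
  | zero => simp [st, Latt]
  | succ n ih => exact ins_latt (ih _) _

lemma st_inc (n : ℕ) (σ : Equiv.Perm (Fin n)) (k c : ℕ) (hc : c ≤ n) :
    Inc σ k c ↔ k ≤ LL (st n σ) c := by
  induction n generalizing k c with
  | zero =>
    simp only [st, LL, Nat.le_zero]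
    constructor
    · rintro ⟨s, -⟩
      by_contra h
      exact (s ⟨0, by omega⟩).elim0
    · rintro rfl
      exact ⟨fun i => i.elim0, fun i => i.elim0, fun i => i.elim0, fun i => i.elim0⟩
  | succ n ih =>
    obtain ⟨⟨τ, v⟩, rfl⟩ := (extEquiv n).surjective σ
    rw [st_ext]
    show _ ↔ k ≤ LL (ins (st n τ) v.val).1 c
    have hl := st_len n τ
    have hvn : v.val ≤ n := by omega
    have e : (⇑(extEquiv n (τ, v)) : Fin (n + 1) → Fin (n + 1)) = extP τ v := rfl
    rw [e]
    by_cases hcv : c ≤ v.val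
    · rw [inc_low _ _ _ _ hcv, LL_ins_low _ _ _ (by omega) hcv, ih _ _ _ (by omega)]
    · obtain ⟨c, rfl⟩ : ∃ c', c = c' + 1 := ⟨c - 1, by omega⟩
      rw [inc_high _ _ _ _ (by omega), LL_ins_high _ _ _ (by omega) (by omega),
        ih _ _ _ (by omega)]
      simp only [ih _ _ v.val hvn]
      constructor
      · rintro (h | ⟨k', rfl, h⟩) <;> simp <;> omega
      · intro h
        by_cases h' : k ≤ LL (st n τ) c
        · exact Or.inl h'
        · simp at h
          exact Or.inr ⟨k - 1, by omega, by omega⟩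

lemma containsInc_iff (n k : ℕ) (σ : Equiv.Perm (Fin n)) :
    ContainsInc n k σ ↔ k ≤ (st n σ).count 0 := by
  rw [← LL_full (st n σ) n (st_len n σ).le, ← st_inc n σ k n le_rfl]
  constructor
  · rintro ⟨s, h1, h2⟩
    exact ⟨s, h1, h2, fun i => (σ (s i)).isLt⟩
  · rintro ⟨s, h1, h2, -⟩
    exact ⟨s, h1, h2⟩

/-! Counting -/

def dec (c : ℕ → ℕ) (r : ℕ) : ℕ → ℕ := fun x => if x = r then c x - 1 else c x

def Wd : ℕ → (ℕ → ℕ) → Finset (List ℕ)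
  | 0, c => if (∀ x ∈ Finset.range 4, c x = 0) then {[]} else ∅
  | n + 1, c => ((Finset.range 4).filter (fun r => c (r + 1) < c r)).biUnion
      fun r => (Wd n (dec c r)).image (List.cons r)

def Good (c : ℕ → ℕ) : Prop := (∀ x, c (x + 1) ≤ c x) ∧ ∀ x, 4 ≤ x → c x = 0

lemma Good.dec {c : ℕ → ℕ} (h : Good c) {r : ℕ} (hr : c (r + 1) < c r) : Good (dec c r) := by
  refine ⟨fun x => ?_, fun x hx => ?_⟩
  · have := h.1 x
    simp only [_root_.dec]
    by_cases hx : x = r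
    · subst hx; simp; omega
    · simp only [hx, if_false]; split_ifs <;> omega
  · have := h.2 x hx
    simp only [_root_.dec]; split_ifs <;> omega

lemma mem_Wd (n : ℕ) (c : ℕ → ℕ) (hc : Good c) (w : List ℕ) :
    w ∈ Wd n c ↔ Latt w ∧ w.length = n ∧ ∀ x, w.count x = c x := by
  induction n generalizing c w with
  | zero =>
    simp only [Wd]
    constructor
    · split_ifs with h
      · intro hw
        simp at hw
        subst hw
        refine ⟨trivial, rfl, fun x => ?_⟩
        by_cases hx : x < 4
        · rw [h x (by simpa using hx)]; simp
        · rw [hc.2 x (by omega)]; simp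
      · simp
    · rintro ⟨-, h2, h3⟩
      rw [List.length_eq_zero_iff] at h2
      subst h2
      rw [if_pos]
      · simp
      · intro x _; rw [← h3]; simp
  | succ n ih =>
    simp only [Wd, Finset.mem_biUnion, Finset.mem_filter, Finset.mem_image, Finset.mem_range]
    constructor
    · rintro ⟨r, ⟨hr4, hr⟩, u, hu, rfl⟩
      rw [ih _ (hc.dec hr)] at hu
      obtain ⟨h1, h2, h3⟩ := hu
      refine ⟨⟨h1, ?_⟩, by simp [h2], ?_⟩
      · by_cases h0 : r = 0
        · exact Or.inl h0
        · right
          rw [h3, h3]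
          obtain ⟨r, rfl⟩ : ∃ r', r = r' + 1 := ⟨r - 1, by omega⟩
          have := hc.1 r
          simp [dec]; omega
      · intro x
        rw [List.count_cons, h3]
        simp only [dec, beq_iff_eq]
        by_cases hx : x = r
        · subst hx; simp; omega
        · simp [hx, Ne.symm hx]
    · rintro ⟨h1, h2, h3⟩
      cases w with
      | nil => simp at h2
      | cons s u =>
        obtain ⟨h1, h1'⟩ := h1
        have hs : c (s + 1) < c s := by
          rw [← h3, ← h3]
          have := h1.anti s
          simp; omega
        have hs4 : s < 4 := by
          by_contra h
          have := hc.2 s (by omega)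
          omega
        refine ⟨s, ⟨hs4, hs⟩, u, ?_, rfl⟩
        rw [ih _ (hc.dec hs)]
        refine ⟨h1, by simpa using h2, fun x => ?_⟩
        have := h3 x
        rw [List.count_cons] at this
        simp only [dec, beq_iff_eq] at this ⊢
        by_cases hx : x = s
        · subst hx; simp at this ⊢; omega
        · simp [hx, Ne.symm hx] at this ⊢; exact this

lemma card_Wd_succ (n : ℕ) (c : ℕ → ℕ) :
    (Wd (n + 1) c).card =
      ∑ r ∈ Finset.range 4, if c (r + 1) < c r then (Wd n (dec c r)).card else 0 := by
  rw [Wd, Finset.card_biUnion, ← Finset.sum_filter]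
  · refine Finset.sum_congr rfl fun r _ => ?_
    exact Finset.card_image_of_injective _ (List.cons_injective)
  · intro a _ b _ hab
    show Disjoint _ _
    rw [Finset.disjoint_left]
    intro u hu hu'
    simp only [Finset.mem_image] at hu hu'
    obtain ⟨x, -, rfl⟩ := hu
    obtain ⟨y, -, h⟩ := hu'
    simp at h
    exact hab h.1.symm

lemma Latt.good {w : List ℕ} (h : Latt w) (h4 : w.count 4 = 0) : Good (fun x => w.count x) := by
  refine ⟨h.anti, fun x hx => ?_⟩
  induction x, hx using Nat.le_induction with
  | base => exact h4
  | succ x hx ih => have := h.anti x; simp only at ih ⊢; omega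

lemma card_st (n : ℕ) (w : List ℕ) (hw : Latt w) (hl : w.length = n) (h4 : w.count 4 = 0) :
    (Finset.univ.filter (fun σ : Equiv.Perm (Fin n) => st n σ = w)).card =
      (Wd n (fun x => w.count x)).card := by
  induction n generalizing w with
  | zero =>
    rw [List.length_eq_zero_iff] at hl
    subst hl
    simp [st, Wd]
  | succ n ih =>
    have hg := hw.good h4
    rw [card_Wd_succ]
    have e1 : (Finset.univ.filter (fun σ : Equiv.Perm (Fin (n + 1)) => st (n + 1) σ = w)).card =
        (Finset.univ.filter (fun p : Equiv.Perm (Fin n) × Fin (n + 1) =>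
          (ins (st n p.1) p.2.val).1 = w)).card := by
      symm
      refine Finset.card_equiv (extEquiv n) fun p => ?_
      simp [st_ext]
    rw [e1, Finset.card_eq_sum_card_fiberwise
      (f := fun p : Equiv.Perm (Fin n) × Fin (n + 1) => (ins (st n p.1) p.2.val).2)
      (t := Finset.range 4)]
    · refine Finset.sum_congr rfl fun r _ => ?_
      rw [Finset.filter_filter]
      split_ifs with hr
      · obtain ⟨d1, d2, d3, d4, d5⟩ := del_spec hw r hr
        have hd : dec (fun x => w.count x) r = fun x => (del w r).1.count x := by
          funext x
          have := d4 x
          simp only [dec]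
          split_ifs at this ⊢ <;> omega
        rw [hd, ← ih (del w r).1 d1 (by omega) (by have := d4 4; omega)]
        refine Finset.card_nbij' (fun p => p.1)
          (fun τ => (τ, ⟨(del w r).2, by omega⟩)) ?_ ?_ ?_ ?_
        · rintro ⟨τ, v⟩ hp
          simp only [Finset.coe_filter, Finset.mem_univ, true_and, Set.mem_ofPred_eq] at hp ⊢
          have := del_ins (st n τ) v.val (by rw [st_len]; omega)
          rw [hp.1, hp.2] at this
          rw [this]
        · intro τ hp
          simp only [Finset.coe_filter, Finset.mem_univ, true_and, Set.mem_ofPred_eq] at hp ⊢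
          rw [hp, d5]
          simp
        · rintro ⟨τ, v⟩ hp
          simp only [Finset.coe_filter, Finset.mem_univ, true_and, Set.mem_ofPred_eq] at hp ⊢
          have := del_ins (st n τ) v.val (by rw [st_len]; omega)
          rw [hp.1, hp.2] at this
          simp [this]
        · intro τ _; rfl
      · rw [Finset.card_eq_zero, Finset.filter_eq_empty_iff]
        rintro ⟨τ, v⟩ - ⟨ha, hb⟩
        apply hr
        simp only at ha hb
        rw [← ha, ins_count, ins_count, hb]
        have := (st_latt n τ).anti r
        simp; omega
    · rintro ⟨τ, v⟩ hp
      simp only [Finset.coe_filter, Finset.mem_univ, true_and, Set.mem_ofPred_eq] at hp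
      simp only [Finset.coe_range, Set.mem_Iio]
      by_contra h
      have a := hg.2 _ (not_lt.mp h)
      simp only at a
      have b := ins_count (st n τ) v.val (ins (st n τ) v.val).2
      rw [hp, a] at b
      simp at b

open Classical in
lemma card_fiber (n : ℕ) (c : ℕ → ℕ) (hc : Good c) :
    (Finset.univ.filter (fun σ : Equiv.Perm (Fin n) => ∀ x, (st n σ).count x = c x)).card =
      (Wd n c).card ^ 2 := by
  rw [Finset.card_eq_sum_card_fiberwise (f := st n) (t := Wd n c)]
  · rw [sq, ← smul_eq_mul, ← Finset.sum_const]
    refine Finset.sum_congr rfl fun w hw => ?_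
    rw [mem_Wd n c hc] at hw
    obtain ⟨h1, h2, h3⟩ := hw
    have e : c = fun x => w.count x := by funext x; exact (h3 x).symm
    have := card_st n w h1 h2 (by rw [h3]; exact hc.2 4 le_rfl)
    rw [← e] at this
    rw [← this, Finset.filter_filter]
    congr 1
    ext σ
    simp only [Finset.mem_filter, Finset.mem_univ, true_and]
    constructor
    · exact fun h => h.2
    · intro h; exact ⟨fun x => by rw [h, h3], h⟩
  · intro σ hσ
    simp only [Finset.coe_filter, Finset.mem_univ, true_and, Set.mem_ofPred_eq] at hσ
    exact Finset.mem_coe.mpr ((mem_Wd n c hc _).mpr ⟨st_latt n σ, st_len n σ, hσ⟩)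

def mk (a b c e : ℕ) : ℕ → ℕ
  | 0 => a
  | 1 => b
  | 2 => c
  | 3 => e
  | _ => 0

def Fn (n a b c e : ℕ) : ℕ := (Wd n (mk a b c e)).card

lemma Fn_succ (n a b c e : ℕ) : Fn (n + 1) a b c e =
    (if b < a then Fn n (a - 1) b c e else 0) + (if c < b then Fn n a (b - 1) c e else 0) +
    (if e < c then Fn n a b (c - 1) e else 0) + (if 0 < e then Fn n a b c (e - 1) else 0) := by
  have h0 : dec (mk a b c e) 0 = mk (a - 1) b c e := by
    funext x; rcases x with _ | _ | _ | _ | x <;> simp [dec, mk]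
  have h1 : dec (mk a b c e) 1 = mk a (b - 1) c e := by
    funext x; rcases x with _ | _ | _ | _ | x <;> simp [dec, mk]
  have h2 : dec (mk a b c e) 2 = mk a b (c - 1) e := by
    funext x; rcases x with _ | _ | _ | _ | x <;> simp [dec, mk]
  have h3 : dec (mk a b c e) 3 = mk a b c (e - 1) := by
    funext x; rcases x with _ | _ | _ | _ | x <;> simp [dec, mk]
  rw [Fn, card_Wd_succ]
  simp only [Finset.sum_range_succ, Finset.sum_range_zero, zero_add, h0, h1, h2, h3]
  rfl

lemma Fn0 (m : ℕ) : Fn m m 0 0 0 = 1 := by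
  induction m with
  | zero => decide
  | succ m ih => rw [Fn_succ]; simp [ih]

lemma Fn1 (m : ℕ) : Fn (m + 2) (m + 1) 1 0 0 = m + 1 := by
  induction m with
  | zero => rw [Fn_succ]; simp [Fn0]
  | succ m ih => rw [Fn_succ]; simp [ih, Fn0]

lemma Fn2 (m : ℕ) : 2 * Fn (m + 4) (m + 2) 2 0 0 = (m + 4) * (m + 1) := by
  induction m with
  | zero => rw [Fn_succ]; have := Fn1 1; simp at this ⊢; simp [this]
  | succ m ih =>
    rw [Fn_succ]; have := Fn1 (m + 2); simp [add_assoc] at this ih ⊢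
    simp only [this, mul_add, ih]; ring

lemma Fn11 (m : ℕ) : 2 * Fn (m + 3) (m + 1) 1 1 0 = (m + 2) * (m + 1) := by
  induction m with
  | zero => rw [Fn_succ]; have := Fn1 0; simp at this ⊢; simp [this]
  | succ m ih =>
    rw [Fn_succ]; have := Fn1 (m + 1); simp [add_assoc] at this ih ⊢
    simp only [this, mul_add, ih]; ring

lemma Fn3 (m : ℕ) : 6 * Fn (m + 6) (m + 3) 3 0 0 = (m + 6) * (m + 5) * (m + 1) := by
  induction m with
  | zero => rw [Fn_succ]; have := Fn2 1; simp at this ⊢; omega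
  | succ m ih =>
    rw [Fn_succ]; have := Fn2 (m + 2); simp [add_assoc] at this ih ⊢
    have e : ∀ x, 6 * x = 3 * (2 * x) := fun x => by ring
    rw [mul_add, ih, e, this]; ring

lemma Fn21 (m : ℕ) : 3 * Fn (m + 5) (m + 2) 2 1 0 = (m + 5) * (m + 3) * (m + 1) := by
  suffices h : 6 * Fn (m + 5) (m + 2) 2 1 0 = 2 * ((m + 5) * (m + 3) * (m + 1)) by omega
  have e : ∀ x, 6 * x = 3 * (2 * x) := fun x => by ring
  induction m with
  | zero =>
    rw [Fn_succ]; have := Fn2 0; have := Fn11 1; simp at *; omega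
  | succ m ih =>
    rw [Fn_succ]; have h1 := Fn2 (m + 1); have h2 := Fn11 (m + 2)
    simp [add_assoc] at h1 h2 ih ⊢
    rw [mul_add, mul_add, ih, e, h2, e, h1]; ring

lemma Fn111 (m : ℕ) : 6 * Fn (m + 4) (m + 1) 1 1 1 = (m + 3) * (m + 2) * (m + 1) := by
  have e : ∀ x, 6 * x = 3 * (2 * x) := fun x => by ring
  induction m with
  | zero => rw [Fn_succ]; have := Fn11 0; simp at this ⊢; omega
  | succ m ih =>
    rw [Fn_succ]; have := Fn11 (m + 1); simp [add_assoc] at this ih ⊢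
    rw [mul_add, ih, e, this]; ring

lemma count_sum_le (w : List ℕ) :
    w.count 0 + w.count 1 + w.count 2 + w.count 3 + w.count 4 ≤ w.length := by
  induction w with
  | nil => simp
  | cons s w ih =>
    simp only [List.count_cons, beq_iff_eq, List.length_cons]
    split_ifs <;> omega

lemma count_sum_eq (w : List ℕ) (h : ∀ x ∈ w, x < 4) :
    w.count 0 + w.count 1 + w.count 2 + w.count 3 = w.length := by
  induction w with
  | nil => simp
  | cons s w ih =>
    have := ih fun x hx => h x (List.mem_cons_of_mem _ hx)
    have := h s List.mem_cons_self
    simp only [List.count_cons, beq_iff_eq, List.length_cons]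
    split_ifs <;> omega

lemma Latt.sum_eq {w : List ℕ} (h : Latt w) (h4 : w.count 4 = 0) :
    w.count 0 + w.count 1 + w.count 2 + w.count 3 = w.length := by
  refine count_sum_eq w fun x hx => ?_
  by_contra hx4
  have : w.count x = 0 := (h.good h4).2 x (by omega)
  have := List.count_pos_iff.mpr hx
  omega

def tup (w : List ℕ) : ℕ × ℕ × ℕ × ℕ := (w.count 0, w.count 1, w.count 2, w.count 3)

lemma card_tup (n a b c e : ℕ) (h1 : b ≤ a) (h2 : c ≤ b) (h3 : e ≤ c) (hn : a + b + c + e = n) :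
    (Finset.univ.filter (fun σ : Equiv.Perm (Fin n) => tup (st n σ) = (a, b, c, e))).card =
      Fn n a b c e ^ 2 := by
  have hg : Good (mk a b c e) := by
    refine ⟨fun x => ?_, fun x hx => ?_⟩
    · rcases x with _ | _ | _ | _ | x <;> simp [mk, *]
    · rcases x with _ | _ | _ | _ | x <;> simp [mk] <;> omega
  rw [Fn, ← card_fiber n _ hg]
  refine congrArg Finset.card ?_
  ext σ
  simp only [Finset.mem_filter, Finset.mem_univ, true_and, tup, Prod.mk.injEq]
  constructor
  · rintro ⟨ha, hb, hc, he⟩ x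
    have hl := st_len n σ
    have hs := count_sum_le (st n σ)
    have h4 : (st n σ).count 4 = 0 := by omega
    have hg' := (st_latt n σ).good h4
    rcases x with _ | _ | _ | _ | x
    · exact ha
    · exact hb
    · exact hc
    · exact he
    · exact hg'.2 _ (by omega)
  · intro h
    exact ⟨h 0, h 1, h 2, h 3⟩

lemma B_eq (m : ℕ) : ∃ z, 6 * z = (m + 5) * (m + 4) * m ∧ B (m + 2) (m + 2 + 3) =
    Fn (m + 5) (m + 5) 0 0 0 ^ 2 + Fn (m + 5) (m + 4) 1 0 0 ^ 2 + Fn (m + 5) (m + 3) 2 0 0 ^ 2 +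
    Fn (m + 5) (m + 3) 1 1 0 ^ 2 + z ^ 2 + Fn (m + 5) (m + 2) 2 1 0 ^ 2 +
    Fn (m + 5) (m + 2) 1 1 1 ^ 2 := by
  classical
  refine ⟨if m = 0 then 0 else Fn (m + 5) (m + 2) 3 0 0, ?_, ?_⟩
  · cases m with
    | zero => simp
    | succ m => have := Fn3 m; simpa using this
  have hz : (Finset.univ.filter
      (fun σ : Equiv.Perm (Fin (m + 5)) => tup (st (m + 5) σ) = (m + 2, 3, 0, 0))).card =
      (if m = 0 then 0 else Fn (m + 5) (m + 2) 3 0 0) ^ 2 := by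
    split_ifs with h
    · subst h
      rw [zero_pow (by norm_num), Finset.card_eq_zero, Finset.filter_eq_empty_iff]
      intro σ _ hσ
      simp only [tup, Prod.mk.injEq] at hσ
      have := (st_latt _ σ).anti 0
      simp only [zero_add] at this
      omega
    · exact card_tup _ _ _ _ _ (by omega) (by omega) (by omega) (by omega)
  have hB : B (m + 2) (m + 2 + 3) = (Finset.univ.filter
      (fun σ : Equiv.Perm (Fin (m + 5)) => m + 2 ≤ (st (m + 5) σ).count 0)).card := by
    rw [B, Nat.card_eq_fintype_card, Fintype.card_subtype]
    congr 1
    ext σ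
    simp only [Finset.mem_filter, Finset.mem_univ, true_and]
    exact containsInc_iff _ _ _
  rw [hB, Finset.card_eq_sum_card_fiberwise (f := fun σ => tup (st (m + 5) σ))
    (t := {(m + 5, 0, 0, 0), (m + 4, 1, 0, 0), (m + 3, 2, 0, 0), (m + 3, 1, 1, 0),
      (m + 2, 3, 0, 0), (m + 2, 2, 1, 0), (m + 2, 1, 1, 1)})]
  · have hf : ∀ a b c e : ℕ, m + 2 ≤ a → ((Finset.univ.filter
        (fun σ : Equiv.Perm (Fin (m + 5)) => m + 2 ≤ (st (m + 5) σ).count 0)).filter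
        (fun σ => tup (st (m + 5) σ) = (a, b, c, e))).card = (Finset.univ.filter
        (fun σ : Equiv.Perm (Fin (m + 5)) => tup (st (m + 5) σ) = (a, b, c, e))).card := by
      intro a b c e ha
      rw [Finset.filter_filter]
      congr 1
      ext σ
      simp only [Finset.mem_filter, Finset.mem_univ, true_and, and_iff_right_iff_imp]
      intro h
      simp only [tup, Prod.mk.injEq] at h
      omega
    rw [Finset.sum_insert (by simp), Finset.sum_insert (by simp), Finset.sum_insert (by simp),
      Finset.sum_insert (by simp), Finset.sum_insert (by simp), Finset.sum_insert (by simp),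
      Finset.sum_singleton, hf _ _ _ _ (by omega), hf _ _ _ _ (by omega), hf _ _ _ _ (by omega),
      hf _ _ _ _ (by omega), hf _ _ _ _ (by omega), hf _ _ _ _ (by omega),
      hf _ _ _ _ (by omega), hz,
      card_tup _ _ _ _ _ (by omega) (by omega) (by omega) (by omega),
      card_tup _ _ _ _ _ (by omega) (by omega) (by omega) (by omega),
      card_tup _ _ _ _ _ (by omega) (by omega) (by omega) (by omega),
      card_tup _ _ _ _ _ (by omega) (by omega) (by omega) (by omega),
      card_tup _ _ _ _ _ (by omega) (by omega) (by omega) (by omega),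
      card_tup _ _ _ _ _ (by omega) (by omega) (by omega) (by omega)]
    ring
  · intro σ hσ
    simp only [Finset.coe_filter, Finset.mem_univ, true_and, Set.mem_ofPred_eq] at hσ
    have hl := st_len _ σ
    have hs := count_sum_le (st _ σ)
    have hL := st_latt _ σ
    have a0 := hL.anti 0
    have a1 := hL.anti 1
    have a2 := hL.anti 2
    have a3 := hL.anti 3
    simp only [zero_add, Nat.reduceAdd] at a0 a1 a2 a3
    have h4 : (st (m + 5) σ).count 4 = 0 := by omega
    have := hL.sum_eq h4
    simp only [tup, Finset.coe_insert, Finset.coe_singleton, Set.mem_insert_iff,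
      Set.mem_singleton_iff, Prod.mk.injEq]
    rw [hl] at this
    clear hs h4 hl hL a3
    generalize (st (m + 5) σ).count 0 = a at *
    generalize (st (m + 5) σ).count 1 = b at *
    generalize (st (m + 5) σ).count 2 = c at *
    generalize (st (m + 5) σ).count 3 = e at *
    have hb : b ≤ 3 := by omega
    have hc : c ≤ 1 := by omega
    have he : e ≤ 1 := by omega
    clear hz hB
    interval_cases b <;> interval_cases c <;> interval_cases e <;> simp <;> omega

/-- For every `d ≥ 2`,
`6·B_d(d+3) = d⁶ + 6d⁵ + 10d⁴ + 4d³ + 19d² + 62d + 66`. -/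
theorem stmt3 (d : ℕ) (hd : 2 ≤ d) :
    6 * B d (d + 3) =
      d ^ 6 + 6 * d ^ 5 + 10 * d ^ 4 + 4 * d ^ 3 + 19 * d ^ 2 + 62 * d + 66 := by
  obtain ⟨m, rfl⟩ : ∃ m, d = m + 2 := ⟨d - 2, by omega⟩
  obtain ⟨z, hz, hB⟩ := B_eq m
  have h0 : Fn (m + 5) (m + 5) 0 0 0 = 1 := Fn0 _
  have h1 : Fn (m + 5) (m + 4) 1 0 0 = m + 4 := Fn1 (m + 3)
  have h2 : 2 * Fn (m + 5) (m + 3) 2 0 0 = (m + 5) * (m + 2) := Fn2 (m + 1)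
  have h3 : 2 * Fn (m + 5) (m + 3) 1 1 0 = (m + 4) * (m + 3) := Fn11 (m + 2)
  have h4 : 3 * Fn (m + 5) (m + 2) 2 1 0 = (m + 5) * (m + 3) * (m + 1) := Fn21 m
  have h5 : 6 * Fn (m + 5) (m + 2) 1 1 1 = (m + 4) * (m + 3) * (m + 2) := Fn111 (m + 1)
  rw [h0, h1] at hB
  generalize Fn (m + 5) (m + 3) 2 0 0 = x at *
  generalize Fn (m + 5) (m + 3) 1 1 0 = y at *
  generalize Fn (m + 5) (m + 2) 2 1 0 = t at *
  generalize Fn (m + 5) (m + 2) 1 1 1 = u at *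
  have key : 6 * (6 * B (m + 2) (m + 2 + 3)) = 36 + 36 * (m + 4) ^ 2 + 9 * (2 * x) ^ 2 +
      9 * (2 * y) ^ 2 + (6 * z) ^ 2 + 4 * (3 * t) ^ 2 + (6 * u) ^ 2 := by
    rw [hB]; ring
  rw [h2, h3, h4, h5, hz] at key
  refine Nat.eq_of_mul_eq_mul_left (by norm_num : 0 < 6) ?_
  rw [key]
  ring
end

section
/- The sum over all partitions λ of n of (f_λ)^2 equals n!, where f_λ is the number of standard Young tableaux of shape λ (the RSK identity). -/
/-- Cell `(i,j)` (0-indexed row `i`, column `j`) belongs to the Young diagram of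
the partition with parts-multiset `P`: column `j` has height equal to the number
of parts exceeding `j`. -/
def InShape (P : Multiset ℕ) (i j : ℕ) : Prop :=
  i < (P.filter (fun p => j < p)).card

instance (P : Multiset ℕ) (i j : ℕ) : Decidable (InShape P i j) := by
  unfold InShape; infer_instance

/-- The finite set of cells of the Young diagram of `P`. -/
def shapeCells (P : Multiset ℕ) : Finset (ℕ × ℕ) :=
  (Finset.range P.card ×ˢ Finset.range P.sum).filter (fun c => InShape P c.1 c.2)

/-- `sytCount P` is the number of standard Young tableaux of shape `P`:
bijective fillings of the cells by `0, …, |P| - 1` that strictly increase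
along rows and down columns. -/
noncomputable def sytCount (P : Multiset ℕ) : ℕ :=
  Nat.card {T : {c : ℕ × ℕ // c ∈ shapeCells P} → Fin P.sum //
    Function.Injective T ∧
    ∀ a b : {c : ℕ × ℕ // c ∈ shapeCells P},
      a.1.1 ≤ b.1.1 → a.1.2 ≤ b.1.2 → a ≠ b → T a < T b}

open Finset

namespace RSKAux

/-- `S` is a Young diagram. -/
def Low (S : Finset (ℕ × ℕ)) : Prop := ∀ a ∈ S, ∀ b, b ≤ a → b ∈ S

def IsTab (S : Finset (ℕ × ℕ)) (T : ℕ × ℕ → ℕ) : Prop :=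
  (∀ c, c ∉ S → T c = 0) ∧ (∀ c ∈ S, T c < S.card) ∧
  (∀ a ∈ S, ∀ b ∈ S, T a = T b → a = b) ∧
  (∀ a ∈ S, ∀ b ∈ S, a ≤ b → a ≠ b → T a < T b)

abbrev Tab (S : Finset (ℕ × ℕ)) := {T : ℕ × ℕ → ℕ // IsTab S T}

noncomputable def f (S : Finset (ℕ × ℕ)) : ℕ := Nat.card (Tab S)

instance (S : Finset (ℕ × ℕ)) : Finite (Tab S) := by
  let g : Tab S → (S → Fin S.card) := fun T c => ⟨T.1 c.1, T.2.2.1 c.1 c.2⟩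
  apply Finite.of_injective g
  intro T T' h
  apply Subtype.ext
  funext c
  by_cases hc : c ∈ S
  · have := congrArg Fin.val (congrFun h ⟨c, hc⟩)
    exact this
  · rw [T.2.1 c hc, T'.2.1 c hc]

open Classical in
noncomputable def rem (S : Finset (ℕ × ℕ)) : Finset (ℕ × ℕ) := S.filter (fun c => Low (S.erase c))

open Classical in
noncomputable def add (S : Finset (ℕ × ℕ)) : Finset (ℕ × ℕ) :=
  (range (S.card + 1) ×ˢ range (S.card + 1)).filter (fun c => c ∉ S ∧ Low (insert c S))

lemma mem_rem {S c} : c ∈ rem S ↔ c ∈ S ∧ Low (S.erase c) := by simp [rem]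

lemma low_bound {S : Finset (ℕ × ℕ)} (h : Low S) {i j : ℕ} (hc : (i, j) ∈ S) :
    i < S.card ∧ j < S.card := by
  constructor
  · have : (range (i+1)).image (fun k => (k, j)) ⊆ S := by
      intro x hx
      simp only [mem_image, mem_range] at hx
      obtain ⟨k, hk, rfl⟩ := hx
      exact h _ hc _ (Prod.mk_le_mk.2 ⟨by omega, le_rfl⟩)
    have h2 := card_le_card this
    rw [card_image_of_injective _ (by intro a b; simp), card_range] at h2
    exact h2
  · have : (range (j+1)).image (fun k => (i, k)) ⊆ S := by
      intro x hx
      simp only [mem_image, mem_range] at hx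
      obtain ⟨k, hk, rfl⟩ := hx
      exact h _ hc _ (Prod.mk_le_mk.2 ⟨le_rfl, by omega⟩)
    have h2 := card_le_card this
    rw [card_image_of_injective _ (by intro a b; simp), card_range] at h2
    exact h2

lemma mem_add {S c} : c ∈ add S ↔ c ∉ S ∧ Low (insert c S) := by
  simp only [add, mem_filter, mem_product, mem_range, and_iff_right_iff_imp]
  rintro ⟨h1, h2⟩
  have := low_bound (i := c.1) (j := c.2) h2 (mem_insert_self _ _)
  rwa [card_insert_of_notMem h1] at this

lemma f_rec (S : Finset (ℕ × ℕ)) (hL : Low S) (hne : S.Nonempty) :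
    f S = ∑ c ∈ rem S, f (S.erase c) := by
  have hpos := hne.card_pos
  have key : ∀ c ∈ S, ∀ x ∈ S, x ≠ c → ∀ T : Tab (S.erase c), T.1 x < S.card - 1 := by
    intro c hc x hx hxc T
    have := T.2.2.1 x (mem_erase.2 ⟨hxc, hx⟩)
    rwa [card_erase_of_mem hc] at this
  let g : (Σ c : rem S, Tab (S.erase c.1)) → Tab S := fun p =>
    ⟨Function.update p.2.1 p.1.1 (S.card - 1), by
      obtain ⟨⟨c, hc⟩, T⟩ := p
      obtain ⟨hcS, hcL⟩ := mem_rem.1 hc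
      have k := key c hcS
      refine ⟨?_, ?_, ?_, ?_⟩
      · intro x hx
        have hxc : x ≠ c := by rintro rfl; exact hx hcS
        simp only [Function.update_of_ne hxc]
        exact T.2.1 x (fun h => hx (mem_of_mem_erase h))
      · intro x hx
        by_cases hxc : x = c
        · subst hxc; simp; omega
        · simp only [Function.update_of_ne hxc]
          have := k x hx hxc T
          omega
      · intro a ha b hb hab
        by_cases hac : a = c <;> by_cases hbc : b = c
        · rw [hac, hbc]
        · have := k b hb hbc T
          subst hac
          simp [Function.update_of_ne hbc] at hab
          omega
        · have := k a ha hac T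
          subst hbc
          simp [Function.update_of_ne hac] at hab
          omega
        · simp only [Function.update_of_ne hac, Function.update_of_ne hbc] at hab
          exact T.2.2.2.1 a (mem_erase.2 ⟨hac, ha⟩) b (mem_erase.2 ⟨hbc, hb⟩) hab
      · intro a ha b hb hab hne
        by_cases hac : a = c
        · subst hac
          have := hcL b (mem_erase.2 ⟨hne.symm, hb⟩) a hab
          simp at this
        · by_cases hbc : b = c
          · have := k a ha hac T
            subst hbc
            simpa [Function.update_of_ne hac] using this
          · simp only [Function.update_of_ne hac, Function.update_of_ne hbc]
            exact T.2.2.2.2 a (mem_erase.2 ⟨hac, ha⟩) b (mem_erase.2 ⟨hbc, hb⟩) hab hne⟩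
  have hg : Function.Bijective g := by
    constructor
    · rintro ⟨⟨c, hc⟩, T⟩ ⟨⟨c', hc'⟩, T'⟩ h
      have h1 : Function.update T.1 c (S.card - 1) = Function.update T'.1 c' (S.card - 1) :=
        congrArg Subtype.val h
      have hcc : c = c' := by
        by_contra hcc
        have h2 := congrFun h1 c
        rw [Function.update_self, Function.update_of_ne hcc] at h2
        have := key c' (mem_rem.1 hc').1 c (mem_rem.1 hc).1 hcc T'
        omega
      subst hcc
      have : T = T' := by
        apply Subtype.ext
        funext x
        by_cases hx : x = c
        · subst hx
          rw [T.2.1 x (by simp), T'.2.1 x (by simp)]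
        · have h2 := congrFun h1 x
          rwa [Function.update_of_ne hx, Function.update_of_ne hx] at h2
      subst this
      rfl
    · rintro ⟨T, hT0, hTb, hTi, hTm⟩
      have himg : S.image T = range S.card := by
        apply eq_of_subset_of_card_le
        · intro x hx
          obtain ⟨c, hc, rfl⟩ := mem_image.1 hx
          exact mem_range.2 (hTb c hc)
        · rw [card_range, card_image_of_injOn]
          intro a ha b hb; exact hTi a ha b hb
      have : S.card - 1 ∈ S.image T := by rw [himg]; simp; omega
      obtain ⟨c, hc, hTc⟩ := mem_image.1 this
      have hlt : ∀ x ∈ S, x ≠ c → T x < S.card - 1 := by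
        intro x hx hxc
        have h1 := hTb x hx
        have : T x ≠ T c := fun h => hxc (hTi x hx c hc h)
        omega
      have hcr : c ∈ rem S := by
        refine mem_rem.2 ⟨hc, ?_⟩
        intro a ha b hb
        obtain ⟨hac, haS⟩ := mem_erase.1 ha
        refine mem_erase.2 ⟨?_, hL a haS b hb⟩
        rintro rfl
        have h1 := hTm b hc a haS hb hac.symm
        have h2 := hlt a haS hac
        omega
      refine ⟨⟨⟨c, hcr⟩, ⟨Function.update T c 0, ?_, ?_, ?_, ?_⟩⟩, ?_⟩
      · intro x hx
        by_cases hxc : x = c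
        · subst hxc; simp
        · rw [Function.update_of_ne hxc]
          exact hT0 x (fun h => hx (mem_erase.2 ⟨hxc, h⟩))
      · intro x hx
        obtain ⟨hxc, hxS⟩ := mem_erase.1 hx
        rw [Function.update_of_ne hxc, card_erase_of_mem hc]
        exact hlt x hxS hxc
      · intro a ha b hb hab
        obtain ⟨hac, haS⟩ := mem_erase.1 ha
        obtain ⟨hbc, hbS⟩ := mem_erase.1 hb
        rw [Function.update_of_ne hac, Function.update_of_ne hbc] at hab
        exact hTi a haS b hbS hab
      · intro a ha b hb hab hne
        obtain ⟨hac, haS⟩ := mem_erase.1 ha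
        obtain ⟨hbc, hbS⟩ := mem_erase.1 hb
        rw [Function.update_of_ne hac, Function.update_of_ne hbc]
        exact hTm a haS b hbS hab hne
      · apply Subtype.ext
        show Function.update (Function.update T c 0) c (S.card - 1) = T
        rw [Function.update_idem, ← hTc, Function.update_eq_self]
  have := Nat.card_congr (Equiv.ofBijective g hg)
  rw [f, ← this, Nat.card_sigma]
  exact Finset.sum_coe_sort (rem S) (fun c => f (S.erase c))

lemma card_add (S : Finset (ℕ × ℕ)) (hL : Low S) : (add S).card = (rem S).card + 1 := by
  let Y : YoungDiagram := ⟨S, fun a b hba ha => hL a ha b hba⟩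
  have hY : ∀ i j, (i, j) ∈ S ↔ j < Y.rowLen i := fun i j =>
    (YoungDiagram.mem_iff_lt_rowLen (μ := Y) (i := i) (j := j))
  have anti : ∀ i k, i ≤ k → Y.rowLen k ≤ Y.rowLen i := fun i k h => Y.rowLen_anti i k h
  have hr : ∀ i j, (i, j) ∈ rem S ↔ (Y.rowLen i = j + 1 ∧ Y.rowLen (i+1) ≤ j) := by
    intro i j
    rw [mem_rem, hY]
    constructor
    · rintro ⟨h1, h2⟩
      constructor
      · by_contra hne
        have := h2 (i, j+1) (mem_erase.2 ⟨by simp, (hY _ _).2 (by omega)⟩) (i, j)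
          (Prod.mk_le_mk.2 ⟨le_rfl, by omega⟩)
        simp at this
      · by_contra hne
        have := h2 (i+1, j) (mem_erase.2 ⟨by simp, (hY _ _).2 (by omega)⟩) (i, j)
          (Prod.mk_le_mk.2 ⟨by omega, le_rfl⟩)
        simp at this
    · rintro ⟨h1, h2⟩
      refine ⟨by omega, ?_⟩
      rintro ⟨a1, a2⟩ ha b hb
      obtain ⟨hac, haS⟩ := mem_erase.1 ha
      refine mem_erase.2 ⟨?_, hL _ haS b hb⟩
      rintro rfl
      obtain ⟨h3, h4⟩ := Prod.mk_le_mk.1 hb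
      rw [hY] at haS
      rcases h3.eq_or_lt with rfl | h3
      · apply hac
        have : a2 = j := by omega
        rw [this]
      · have := anti (i+1) a1 h3
        omega
  have ha : ∀ i j, (i, j) ∈ add S ↔ (Y.rowLen i = j ∧ (i = 0 ∨ j < Y.rowLen (i-1))) := by
    intro i j
    rw [mem_add, hY]
    constructor
    · rintro ⟨h1, h2⟩
      constructor
      · by_contra hne
        have := h2 (i, j) (mem_insert_self _ _) (i, j-1) (Prod.mk_le_mk.2 ⟨le_rfl, by omega⟩)
        rw [mem_insert, hY, Prod.mk.injEq] at this
        omega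
      · by_contra hne
        have := h2 (i, j) (mem_insert_self _ _) (i-1, j) (Prod.mk_le_mk.2 ⟨by omega, le_rfl⟩)
        rw [mem_insert, hY, Prod.mk.injEq] at this
        omega
    · rintro ⟨h1, h2⟩
      refine ⟨by omega, ?_⟩
      rintro a ha ⟨b1, b2⟩ hb
      rcases mem_insert.1 ha with rfl | haS
      · obtain ⟨h3, h4⟩ := Prod.mk_le_mk.1 hb
        rw [mem_insert, hY, Prod.mk.injEq]
        rcases h3.eq_or_lt with rfl | h3
        · omega
        · have := anti b1 (i-1) (by omega)
          omega
      · exact mem_insert_of_mem (hL _ haS _ hb)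
  have heq : add S = insert (0, Y.rowLen 0)
      ((rem S).image (fun c => (c.1 + 1, Y.rowLen (c.1 + 1)))) := by
    ext ⟨i, j⟩
    rw [ha, mem_insert, mem_image, Prod.mk.injEq]
    constructor
    · rintro ⟨h1, h2⟩
      rcases i with _ | i
      · left; omega
      · right
        simp at h2
        refine ⟨(i, Y.rowLen i - 1), (hr _ _).2 ⟨by omega, by omega⟩, ?_⟩
        simp [h1]
    · rintro (⟨rfl, rfl⟩ | ⟨⟨a, b⟩, hab, h⟩)
      · simp
      · rw [hr] at hab
        simp only [Prod.mk.injEq] at h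
        obtain ⟨rfl, rfl⟩ := h
        refine ⟨rfl, Or.inr ?_⟩
        simp only [Nat.add_sub_cancel]
        omega
  rw [heq, card_insert_of_notMem (by simp), card_image_of_injOn]
  rintro ⟨a, b⟩ hab ⟨a', b'⟩ hab' h
  have h1 := (hr _ _).1 hab
  have h2 := (hr _ _).1 hab'
  simp only [Prod.mk.injEq] at h
  have h3 : a = a' := by omega
  subst h3
  rw [Prod.mk.injEq]
  omega

lemma up (n : ℕ) : ∀ S : Finset (ℕ × ℕ), Low S → S.card = n →
    ∑ c ∈ add S, f (insert c S) = (n + 1) * f S := by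
  induction n with
  | zero =>
    intro S hL hS
    have h0 : S = ∅ := card_eq_zero.1 hS
    have hr : rem S = ∅ := by
      rw [← subset_empty, ← h0]
      exact fun x hx => (mem_rem.1 hx).1
    have hc := card_add S hL
    rw [hr, card_empty] at hc
    obtain ⟨c, hc⟩ := card_eq_one.1 hc
    have hca := mem_add.1 (show c ∈ add S by rw [hc]; simp)
    rw [hc, sum_singleton, f_rec _ hca.2 ⟨c, by simp⟩]
    have : rem (insert c S) = {c} := by
      ext x
      rw [mem_rem]
      subst h0
      simp
      rintro rfl
      intro a ha
      simp at ha
    rw [this, sum_singleton, erase_insert hca.1]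
    simp
  | succ n ih =>
    intro S hL hS
    have e1 : ∑ c ∈ add S, f (insert c S) =
        ∑ c ∈ add S, (f S + ∑ d ∈ (rem (insert c S)).erase c, f ((insert c S).erase d)) := by
      apply sum_congr rfl
      intro c hc
      have hca := mem_add.1 hc
      rw [f_rec _ hca.2 ⟨c, by simp⟩, ← add_sum_erase (a := c), erase_insert hca.1]
      rw [mem_rem, erase_insert hca.1]
      exact ⟨by simp, hL⟩
    have e2 : ∑ d ∈ rem S, ∑ c ∈ add (S.erase d), f (insert c (S.erase d)) =
        ∑ d ∈ rem S, (f S + ∑ c ∈ (add (S.erase d)).erase d, f (insert c (S.erase d))) := by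
      apply sum_congr rfl
      intro d hd
      have hda := mem_rem.1 hd
      rw [← add_sum_erase (a := d), insert_erase hda.1]
      rw [mem_add, insert_erase hda.1]
      exact ⟨by simp, hL⟩
    have e3 : ∑ c ∈ add S, ∑ d ∈ (rem (insert c S)).erase c, f ((insert c S).erase d) =
        ∑ d ∈ rem S, ∑ c ∈ (add (S.erase d)).erase d, f (insert c (S.erase d)) := by
      have : ∑ c ∈ add S, ∑ d ∈ (rem (insert c S)).erase c, f ((insert c S).erase d) =
          ∑ c ∈ add S, ∑ d ∈ (rem (insert c S)).erase c, f (insert c (S.erase d)) := by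
        apply sum_congr rfl
        intro c hc
        apply sum_congr rfl
        intro d hd
        rw [erase_insert_of_ne (mem_erase.1 hd).1.symm]
      rw [this]
      apply sum_comm'
      intro c d
      simp only [mem_add, mem_erase, mem_rem, mem_insert]
      constructor
      · rintro ⟨⟨h1, h2⟩, h3, h4, h5⟩
        have hdS : d ∈ S := h4.resolve_left h3
        rw [erase_insert_of_ne (Ne.symm h3)] at h5
        refine ⟨⟨Ne.symm h3, fun h => h1 h.2, h5⟩, hdS, ?_⟩
        intro a ha b hb
        have h6 := h5 a (mem_insert_of_mem ha) b hb
        have h7 := hL a (mem_of_mem_erase ha) b hb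
        rcases mem_insert.1 h6 with rfl | h
        · exact absurd h7 h1
        · exact h
      · rintro ⟨⟨h1, h2, h3⟩, h4, h5⟩
        refine ⟨⟨fun h => h2 ⟨h1, h⟩, ?_⟩, Ne.symm h1, Or.inr h4, ?_⟩
        · intro a ha b hb
          rcases mem_insert.1 ha with rfl | ha
          · have := h3 a (mem_insert_self _ _) b hb
            exact insert_subset_insert _ (erase_subset _ _) this
          · exact mem_insert_of_mem (hL a ha b hb)
        · rw [erase_insert_of_ne h1]; exact h3
    have e4 : ∑ d ∈ rem S, ∑ c ∈ add (S.erase d), f (insert c (S.erase d)) =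
        (n + 1) * f S := by
      rw [f_rec S hL (card_pos.1 (by omega)), mul_sum]
      apply sum_congr rfl
      intro d hd
      have hda := mem_rem.1 hd
      exact ih _ hda.2 (by rw [card_erase_of_mem hda.1]; omega)
    rw [e1, sum_add_distrib, e3, sum_const, card_add S hL]
    rw [e2, sum_add_distrib, sum_const] at e4
    simp only [smul_eq_mul] at *
    linarith

lemma mem_shape {P : Multiset ℕ} {i j : ℕ} :
    (i, j) ∈ shapeCells P ↔ i < (P.filter (fun p => j < p)).card := by
  rw [shapeCells, mem_filter, mem_product, mem_range, mem_range]
  simp only [InShape, and_iff_right_iff_imp]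
  intro h
  refine ⟨h.trans_le (Multiset.card_le_card (Multiset.filter_le _ _)), ?_⟩
  have : 0 < (P.filter (fun p => j < p)).card := by omega
  obtain ⟨p, hp⟩ := Multiset.card_pos_iff_exists_mem.1 this
  obtain ⟨h1, h2⟩ := Multiset.mem_filter.1 hp
  exact h2.trans_le (Multiset.le_sum_of_mem h1)

lemma low_shape (P : Multiset ℕ) : Low (shapeCells P) := by
  rintro ⟨i, j⟩ h ⟨i', j'⟩ hb
  obtain ⟨h3, h4⟩ := Prod.mk_le_mk.1 hb
  rw [mem_shape] at *
  have : (P.filter (fun p => j < p)).card ≤ (P.filter (fun p => j' < p)).card :=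
    Multiset.card_le_card (Multiset.monotone_filter_right _ (fun p hp => by omega))
  omega

lemma sum_heights (P : Multiset ℕ) (N : ℕ) (hN : ∀ p ∈ P, p ≤ N) :
    ∑ j ∈ range N, (P.filter (fun p => j < p)).card = P.sum := by
  induction P using Multiset.induction_on with
  | empty => simp
  | cons a P ih =>
    have ih' := ih (fun p hp => hN p (Multiset.mem_cons_of_mem hp))
    have ha := hN a (Multiset.mem_cons_self a P)
    rw [Multiset.sum_cons, ← ih']
    have : ∀ j ∈ range N, ((a ::ₘ P).filter (fun p => j < p)).card =
        (if j < a then 1 else 0) + (P.filter (fun p => j < p)).card := by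
      intro j _
      rw [Multiset.filter_cons]
      split_ifs <;> simp [Nat.add_comm]
    rw [sum_congr rfl this, sum_add_distrib, ← card_filter]
    congr 1
    have : (range N).filter (fun j => j < a) = range a := by
      ext x; simp; omega
    rw [this, card_range]

lemma card_shape (P : Multiset ℕ) : (shapeCells P).card = P.sum := by
  rw [← sum_heights P P.sum (fun p hp => Multiset.le_sum_of_mem hp)]
  rw [card_eq_sum_card_fiberwise (f := Prod.snd) (t := range P.sum)]
  · apply sum_congr rfl
    intro j _
    have : (shapeCells P).filter (fun c => c.2 = j) =
        (range (P.filter (fun p => j < p)).card).image (fun i => (i, j)) := by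
      ext ⟨a, b⟩
      simp only [mem_filter, mem_image, mem_range, Prod.mk.injEq]
      rw [mem_shape]
      constructor
      · rintro ⟨h, rfl⟩; exact ⟨a, h, rfl, rfl⟩
      · rintro ⟨i, h, rfl, rfl⟩; exact ⟨h, rfl⟩
    rw [this, card_image_of_injective _ (by intro a b; simp), card_range]
  · rintro ⟨i, j⟩ h
    simp only [shapeCells, coe_filter, Set.mem_ofPred_eq, mem_product] at h
    exact mem_coe.2 h.1.2

lemma shape_inj {n : ℕ} (l m : n.Partition) (h : shapeCells l.parts = shapeCells m.parts) :
    l = m := by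
  have hh : ∀ j, (l.parts.filter (fun p => j < p)).card = (m.parts.filter (fun p => j < p)).card := by
    intro j
    have : ∀ i, i < (l.parts.filter (fun p => j < p)).card ↔
        i < (m.parts.filter (fun p => j < p)).card := by
      intro i; rw [← mem_shape, ← mem_shape, h]
    have h1 := this (l.parts.filter (fun p => j < p)).card
    have h2 := this (m.parts.filter (fun p => j < p)).card
    omega
  have hc : ∀ (P : Multiset ℕ) (j : ℕ), (P.filter (fun p => j < p)).card =
      P.count (j+1) + (P.filter (fun p => j + 1 < p)).card := by
    intro P j
    induction P using Multiset.induction_on with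
    | empty => simp
    | cons a P ih =>
      rw [Multiset.filter_cons, Multiset.filter_cons, Multiset.count_cons, Multiset.card_add,
        Multiset.card_add, ih]
      split_ifs <;> simp <;> omega
  apply Nat.Partition.ext
  ext a
  rcases a with _ | a
  · rw [Multiset.count_eq_zero_of_notMem, Multiset.count_eq_zero_of_notMem]
    · intro h0; exact absurd (m.parts_pos h0) (by simp)
    · intro h0; exact absurd (l.parts_pos h0) (by simp)
  · have h1 := hc l.parts a
    have h2 := hc m.parts a
    have h3 := hh a
    have h4 := hh (a+1)
    omega

lemma shape_surj {n : ℕ} (S : Finset (ℕ × ℕ)) (hL : Low S) (hS : S.card = n) :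
    ∃ l : n.Partition, shapeCells l.parts = S := by
  let Y : YoungDiagram := ⟨S, fun a b hba ha => hL a ha b hba⟩
  let P : Multiset ℕ := (Y.rowLens : Multiset ℕ)
  have hP : shapeCells P = S := by
    ext ⟨i, j⟩
    rw [mem_shape]
    have h1 : (P.filter (fun p => j < p)).card = Y.colLen j := by
      have : P = (Multiset.range (Y.colLen 0)).map Y.rowLen := rfl
      rw [this, Multiset.filter_map, Multiset.card_map]
      have : (Multiset.range (Y.colLen 0)).filter ((fun p => j < p) ∘ Y.rowLen) =
          ((range (Y.colLen 0)).filter (fun i => j < Y.rowLen i)).val := rfl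
      rw [this, card_val]
      have : (range (Y.colLen 0)).filter (fun i => j < Y.rowLen i) = range (Y.colLen j) := by
        ext x
        simp only [mem_filter, mem_range]
        rw [← YoungDiagram.mem_iff_lt_rowLen, YoungDiagram.mem_iff_lt_colLen]
        have := Y.colLen_anti 0 j (by omega)
        omega
      rw [this, card_range]
    rw [h1, ← YoungDiagram.mem_iff_lt_colLen]
    exact Iff.rfl
  refine ⟨⟨P, ?_, ?_⟩, hP⟩
  · intro i hi
    exact Y.pos_of_mem_rowLens i hi
  · rw [← card_shape, hP, hS]

lemma sytCount_eq (P : Multiset ℕ) : sytCount P = f (shapeCells P) := by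
  unfold sytCount f
  apply Nat.card_congr
  have hc := card_shape P
  refine
    { toFun := fun T => ⟨fun c => if h : c ∈ shapeCells P then (T.1 ⟨c, h⟩ : ℕ) else 0, ?_⟩
      invFun := fun T => ⟨fun c => ⟨T.1 c.1, hc ▸ T.2.2.1 c.1 c.2⟩, ?_⟩
      left_inv := ?_
      right_inv := ?_ }
  · obtain ⟨T, hi, hm⟩ := T
    refine ⟨?_, ?_, ?_, ?_⟩
    · intro c h; simp [h]
    · intro c h; simp only [h, dif_pos]; rw [hc]; exact (T _).2
    · intro a ha b hb hab
      simp only [ha, hb, dif_pos] at hab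
      exact congrArg Subtype.val (hi (Fin.ext hab))
    · intro a ha b hb hab hne
      simp only [ha, hb, dif_pos]
      exact hm ⟨a, ha⟩ ⟨b, hb⟩ hab.1 hab.2 (fun h => hne (congrArg Subtype.val h))
  · obtain ⟨T, h0, hb, hi, hm⟩ := T
    constructor
    · intro a b hab
      exact Subtype.ext (hi _ a.2 _ b.2 (congrArg Fin.val hab))
    · intro a b h1 h2 hne
      exact hm _ a.2 _ b.2 ⟨h1, h2⟩ (fun h => hne (Subtype.ext h))
  · intro T
    apply Subtype.ext
    funext c
    apply Fin.ext
    simp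
  · intro T
    apply Subtype.ext
    funext c
    by_cases h : c ∈ shapeCells P
    · simp [h]
    · simp [h, T.2.1 c h]

/-- All Young diagrams with `n` cells. -/
noncomputable def L (n : ℕ) : Finset (Finset (ℕ × ℕ)) :=
  (univ : Finset n.Partition).image (fun l => shapeCells l.parts)

lemma mem_L {n S} : S ∈ L n ↔ Low S ∧ S.card = n := by
  simp only [L, mem_image, mem_univ, true_and]
  constructor
  · rintro ⟨l, rfl⟩
    exact ⟨low_shape _, by rw [card_shape, l.parts_sum]⟩
  · rintro ⟨h1, h2⟩
    exact shape_surj S h1 h2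

lemma main (n : ℕ) : ∑ S ∈ L n, f S ^ 2 = n.factorial := by
  induction n with
  | zero =>
    have : L 0 = {∅} := by
      ext S
      rw [mem_L, mem_singleton, card_eq_zero]
      constructor
      · exact fun h => h.2
      · rintro rfl; exact ⟨by intro a ha; simp at ha, rfl⟩
    rw [this, sum_singleton]
    have : f ∅ = 1 := by
      rw [f, Nat.card_eq_one_iff_unique]
      refine ⟨⟨?_⟩, ⟨⟨fun _ => 0, ?_⟩⟩⟩
      · intro a b
        apply Subtype.ext
        funext c
        rw [a.2.1 c (by simp), b.2.1 c (by simp)]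
      · simp [IsTab]
    rw [this]; rfl
  | succ n ih =>
    have e1 : ∑ S ∈ L (n+1), f S ^ 2 = ∑ S ∈ L (n+1), ∑ c ∈ rem S, f S * f (S.erase c) := by
      apply sum_congr rfl
      intro S hS
      obtain ⟨h1, h2⟩ := mem_L.1 hS
      rw [← mul_sum, ← f_rec S h1 (card_pos.1 (by omega)), sq]
    have e2 : ∑ S ∈ L (n+1), ∑ c ∈ rem S, f S * f (S.erase c) =
        ∑ S ∈ L n, ∑ c ∈ add S, f (insert c S) * f S := by
      rw [sum_sigma', sum_sigma']
      refine sum_bij' (fun p _ => ⟨p.1.erase p.2, p.2⟩) (fun p _ => ⟨insert p.2 p.1, p.2⟩)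
        ?_ ?_ ?_ ?_ ?_
      · rintro ⟨S, c⟩ h
        simp only [mem_sigma, mem_L, mem_rem, mem_add] at h ⊢
        obtain ⟨⟨h1, h2⟩, h3, h4⟩ := h
        refine ⟨⟨h4, by rw [card_erase_of_mem h3]; omega⟩, by simp, ?_⟩
        rw [insert_erase h3]; exact h1
      · rintro ⟨S, c⟩ h
        simp only [mem_sigma, mem_L, mem_rem, mem_add] at h ⊢
        obtain ⟨⟨h1, h2⟩, h3, h4⟩ := h
        refine ⟨⟨h4, by rw [card_insert_of_notMem h3]; omega⟩, by simp, ?_⟩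
        rw [erase_insert h3]; exact h1
      · rintro ⟨S, c⟩ h
        simp only [mem_sigma, mem_rem] at h
        simp only [insert_erase h.2.1]
      · rintro ⟨S, c⟩ h
        simp only [mem_sigma, mem_add] at h
        simp only [erase_insert h.2.1]
      · rintro ⟨S, c⟩ h
        simp only [mem_sigma, mem_rem] at h
        simp only [insert_erase h.2.1]
    rw [e1, e2, Nat.factorial_succ, ← ih, mul_sum]
    apply sum_congr rfl
    intro S hS
    obtain ⟨h1, h2⟩ := mem_L.1 hS
    rw [← sum_mul, up n S h1 h2]
    ring

end RSKAux

/-- RSK identity: `∑_{λ ⊢ n} (f_λ)² = n!`. -/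
theorem stmt19 (n : ℕ) :
    ∑ lam : n.Partition, sytCount lam.parts ^ 2 = Nat.factorial n := by
  rw [← RSKAux.main n, RSKAux.L, Finset.sum_image]
  · exact Finset.sum_congr rfl (fun l _ => by rw [RSKAux.sytCount_eq])
  · intro a _ b _ h
    exact RSKAux.shape_inj a b h
end
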